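/- Let g_ℝ be a real semisimple Lie algebra with Cartan involution θ, complexification g, and let a_ℝ ⊆ g_ℝ^{-θ} be a maximal abelian subspace with complexification a. Let V be an irreducible (g, K)-module such that no simple factor of g acts locally finitely on V. Then V is torsion-free as a module over the polynomial ring U(a) = S(a); equivalently, Ass_{S(a)}(V) = {(0)}. -/

import Mathlib

set_option synthInstance.maxHeartbeats 1000000
set_option maxHeartbeats 2000000

open scoped TensorProduct

namespace SplitAbelian

open MvPolynomial

section Polynomial

variable {ι : Type*}

/-- Translation of polynomials by the vector `l`. -/
noncomputable def translate (l : ι → ℂ) : MvPolynomial ι ℂ →ₐ[ℂ] MvPolynomial ι ℂ :=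
  aeval fun i => X i + C (l i)

lemma translate_X (l : ι → ℂ) (i : ι) : translate l (X i) = X i + C (l i) := by
  simp [translate]

lemma translate_comp (l m : ι → ℂ) : (translate l).comp (translate m) = translate (l + m) := by
  refine MvPolynomial.algHom_ext fun i => ?_
  rw [AlgHom.comp_apply, translate_X, map_add, translate_X, translate_X, Pi.add_apply, C_add,
    add_assoc]
  congr 2
  exact (translate l).commutes _

lemma translate_translate (l m : ι → ℂ) (f : MvPolynomial ι ℂ) :
    translate l (translate m f) = translate (l + m) f :=
  DFunLike.congr_fun (translate_comp l m) f

lemma translate_zero (f : MvPolynomial ι ℂ) : translate 0 f = f := by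
  have : translate (0 : ι → ℂ) = AlgHom.id ℂ _ := by
    refine MvPolynomial.algHom_ext fun i => ?_
    simp [translate_X]
  simp [this]

lemma eval_translate (l z : ι → ℂ) (f : MvPolynomial ι ℂ) :
    eval z (translate l f) = eval (z + l) f := by
  induction f using MvPolynomial.induction_on with
  | C a => simp [translate]
  | add p q hp hq => simp [hp, hq]
  | mul_X p i hp => simp [hp, translate_X]

lemma comap_translate_eq_of_le [Finite ι] {P : Ideal (MvPolynomial ι ℂ)} {l : ι → ℂ}
    (h : P.comap (translate l) ≤ P) : P.comap (translate l) = P := by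
  have key : ∀ (m : ι → ℂ) (Q : Ideal (MvPolynomial ι ℂ)), Q ≤ Q.comap (translate m) →
      Q.comap (translate m) ≤ Q := by
    intro m Q hQ
    obtain ⟨F, hF⟩ : ∃ F : ℕ → Ideal (MvPolynomial ι ℂ),
        ∀ n f, f ∈ F n ↔ translate (n • m) f ∈ Q :=
      ⟨fun n => Q.comap (translate (n • m)), fun n f => Ideal.mem_comap⟩
    have hmono : Monotone F := by
      refine monotone_nat_of_le_succ fun n f hf => ?_
      rw [hF] at hf ⊢
      have := hQ hf
      rwa [Ideal.mem_comap, translate_translate, ← succ_nsmul'] at this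
    obtain ⟨n, hn⟩ := monotone_stabilizes_iff_noetherian.mpr
      (inferInstance : IsNoetherian (MvPolynomial ι ℂ) (MvPolynomial ι ℂ)) ⟨F, hmono⟩
    have hn' : F n = F (n + 1) := hn (n + 1) (Nat.le_succ n)
    intro f hf
    have h1 : translate (-(n • m)) f ∈ F (n + 1) := by
      rw [hF, translate_translate, succ_nsmul', add_neg_cancel_right]
      exact hf
    rwa [← hn', hF, translate_translate, add_neg_cancel, translate_zero] at h1
  refine le_antisymm h ?_
  have h1 : P ≤ P.comap (translate (-l)) := by
    intro f hf
    have : translate (-l) f ∈ P.comap (translate l) := by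
      rw [Ideal.mem_comap, translate_translate, add_neg_cancel, translate_zero]; exact hf
    exact h this
  have h2 := key (-l) P h1
  intro f hf
  rw [Ideal.mem_comap]
  apply h2
  rw [Ideal.mem_comap, translate_translate, neg_add_cancel, translate_zero]
  exact hf

/-- A proper ideal stable under translation by a spanning set of vectors is zero. -/
lemma eq_zero_of_translate_stable [Finite ι] {P : Ideal (MvPolynomial ι ℂ)} (hP : P ≠ ⊤)
    {L : Set (ι → ℂ)} (hL : Submodule.span ℂ L = ⊤)
    (hstab : ∀ l ∈ L, P ≤ P.comap (translate l)) {f : MvPolynomial ι ℂ} (hf : f ∈ P) : f = 0 := by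
  obtain ⟨M, hM, hPM⟩ := Ideal.exists_le_maximal P hP
  obtain ⟨z, hz⟩ := isMaximal_iff_eq_vanishingIdeal_singleton.mp hM
  have hev : ∀ g ∈ P, eval z g = 0 := by
    intro g hg
    have := hPM hg
    rw [hz] at this
    simpa [mem_vanishingIdeal_iff, aeval_eq_eval] using this
  have hcl : ∀ s ∈ AddSubmonoid.closure L, ∀ g ∈ P, translate s g ∈ P := by
    intro s hs
    induction hs using AddSubmonoid.closure_induction with
    | mem x hx => exact fun g hg => hstab x hx hg
    | zero => exact fun g hg => by rwa [translate_zero]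
    | add x y _ _ hx hy =>
      intro g hg
      rw [← translate_translate]
      exact hx _ (hy _ hg)
  have hfin : (⊤ : Submodule ℂ (ι → ℂ)).FG := Module.Finite.fg_top
  rw [← hL, Submodule.fg_span_iff_fg_span_finset_subset] at hfin
  obtain ⟨t, htL, ht⟩ := hfin
  rw [hL] at ht
  -- the pullback of `f` along the parametrisation `n ↦ z + ∑ n_s s`
  let G : MvPolynomial t ℂ := aeval (fun i => C (z i) + ∑ s : t, X s * C (s.1 i)) f
  have hG : ∀ n : t → ℂ, eval n G = eval (z + ∑ s : t, n s • s.1) f := by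
    intro n
    have : (eval n).comp (aeval (R := ℂ) (fun i => C (z i) + ∑ s : t, X s * C (s.1 i))).toRingHom
        = eval (z + ∑ s : t, n s • s.1) := by
      refine MvPolynomial.ringHom_ext ?_ ?_
      · intro r; simp
      · intro i; simp [Finset.sum_apply]
    exact DFunLike.congr_fun this f
  have hG0 : G = 0 := by
    refine MvPolynomial.funext_set (fun _ => Set.range (Nat.cast : ℕ → ℂ))
      (fun _ => Set.infinite_range_of_injective Nat.cast_injective) ?_
    intro n hn
    rw [map_zero, hG]
    choose k hk using fun s : t => hn s (Set.mem_univ _)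
    rw [← eval_translate]
    refine hev _ (hcl _ ?_ _ hf)
    refine sum_mem fun s _ => ?_
    rw [← hk s, Nat.cast_smul_eq_nsmul]
    exact nsmul_mem (AddSubmonoid.subset_closure (htL s.2)) _
  refine MvPolynomial.funext fun y => ?_
  have hy : y - z ∈ Submodule.span ℂ (t : Set (ι → ℂ)) := by rw [← ht]; trivial
  rw [← Subtype.range_coe (s := (t : Set (ι → ℂ))), Submodule.mem_span_range_iff_exists_fun] at hy
  obtain ⟨n, hn⟩ := hy
  have h1 := hG n
  have h2 : z + ∑ s : t, n s • s.1 = y := by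
    rw [show ∑ s : t, n s • s.1 = y - z from hn]; abel
  rw [hG0, map_zero, h2] at h1
  rw [map_zero, ← h1]

end Polynomial

section WeightOperators

variable {ι V : Type*} [AddCommGroup V] [Module ℂ V]

/-- The operators of weight `l` for the adjoint action of the commuting operators `φ (X i)`. -/
def weightOp (φ : MvPolynomial ι ℂ →ₐ[ℂ] Module.End ℂ V) (l : ι → ℂ) :
    Submodule ℂ (Module.End ℂ V) where
  carrier := {u | ∀ i, φ (X i) * u = u * φ (X i) + l i • u}
  add_mem' {u w} hu hw i := by
    rw [mul_add, hu i, hw i, add_mul, smul_add]; abel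
  zero_mem' i := by simp
  smul_mem' c u hu i := by
    rw [mul_smul_comm, hu i, smul_add, smul_mul_assoc, smul_comm]

variable {φ : MvPolynomial ι ℂ →ₐ[ℂ] Module.End ℂ V}

lemma one_mem_weightOp : (1 : Module.End ℂ V) ∈ weightOp φ 0 := fun i => by simp

lemma mul_mem_weightOp {l m : ι → ℂ} {u w : Module.End ℂ V} (hu : u ∈ weightOp φ l)
    (hw : w ∈ weightOp φ m) : u * w ∈ weightOp φ (l + m) := by
  intro i
  rw [← mul_assoc, hu i, add_mul, mul_assoc, hw i, mul_add, smul_mul_assoc, mul_smul_comm,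
    Pi.add_apply, add_smul, mul_assoc]
  abel

/-- The operators which are sums of weight operators. -/
def weightAlgebra (φ : MvPolynomial ι ℂ →ₐ[ℂ] Module.End ℂ V) :
    Subalgebra ℂ (Module.End ℂ V) :=
  Submodule.toSubalgebra (⨆ l, weightOp φ l)
    (Submodule.mem_iSup_of_mem 0 one_mem_weightOp) (by
      intro u w hu hw
      induction hu using Submodule.iSup_induction' with
      | mem l u hu =>
        induction hw using Submodule.iSup_induction' with
        | mem m w hw => exact Submodule.mem_iSup_of_mem (l + m) (mul_mem_weightOp hu hw)
        | zero => rw [mul_zero]; exact zero_mem _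
        | add a b _ _ ha hb => rw [mul_add]; exact add_mem ha hb
      | zero => rw [zero_mul]; exact zero_mem _
      | add a b _ _ ha hb => rw [add_mul]; exact add_mem ha hb)

lemma map_mul_weightOp {l : ι → ℂ} {u : Module.End ℂ V} (hu : u ∈ weightOp φ l)
    (f : MvPolynomial ι ℂ) : φ f * u = u * φ (translate l f) := by
  induction f using MvPolynomial.induction_on with
  | C a =>
    have : φ (C a) = algebraMap ℂ _ a := φ.commutes a
    have h2 : translate l (C a) = C a := (translate l).commutes a
    rw [h2, this]
    exact Algebra.commutes a u
  | add p q hp hq => rw [map_add, add_mul, hp, hq, map_add, map_add, mul_add]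
  | mul_X p i hp =>
    rw [map_mul, mul_assoc, hu i, map_mul, map_mul, translate_X, map_add, mul_add,
      ← mul_assoc, hp, mul_add, mul_smul_comm, hp, mul_assoc, ← mul_assoc u]
    have : φ (C (l i)) = algebraMap ℂ _ (l i) := φ.commutes _
    rw [this, Algebra.algebraMap_eq_smul_one, mul_smul_comm, mul_one, mul_add, mul_smul_comm,
      mul_assoc]

/-- The annihilator of a vector. -/
def vecAnn (φ : MvPolynomial ι ℂ →ₐ[ℂ] Module.End ℂ V) (v : V) : Ideal (MvPolynomial ι ℂ) where
  carrier := {f | φ f v = 0}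
  add_mem' {f g} hf hg := by
    change φ (f + g) v = 0
    rw [map_add, LinearMap.add_apply, hf, hg, add_zero]
  zero_mem' := by simp
  smul_mem' c f hf := by
    change φ (c * f) v = 0
    rw [map_mul, Module.End.mul_apply, hf, map_zero]

lemma mem_vecAnn {v : V} {f : MvPolynomial ι ℂ} : f ∈ vecAnn φ v ↔ φ f v = 0 := Iff.rfl

lemma map_apply_comm (f g : MvPolynomial ι ℂ) (v : V) : φ f (φ g v) = φ g (φ f v) := by
  rw [← Module.End.mul_apply, ← map_mul, mul_comm, map_mul, Module.End.mul_apply]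

lemma vecAnn_ne_top {v : V} (hv : v ≠ 0) : vecAnn φ v ≠ ⊤ := by
  rw [Ne, Ideal.eq_top_iff_one, mem_vecAnn, map_one]
  exact hv

/-- Maximal annihilators of nonzero vectors are prime. -/
lemma vecAnn_isPrime {v : V} (hv : v ≠ 0)
    (hmax : ∀ w : V, w ≠ 0 → vecAnn φ v ≤ vecAnn φ w → vecAnn φ w = vecAnn φ v) :
    (vecAnn φ v).IsPrime := by
  refine ⟨vecAnn_ne_top hv, fun {f g} hfg => ?_⟩
  by_contra! h
  have hg : φ g v ≠ 0 := h.2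
  have h1 : vecAnn φ v ≤ vecAnn φ (φ g v) := by
    intro k hk
    rw [mem_vecAnn, map_apply_comm, mem_vecAnn.mp hk, map_zero]
  refine h.1 ?_
  rw [← hmax _ hg h1, mem_vecAnn, ← Module.End.mul_apply, ← map_mul]
  exact hfg

lemma exists_maximal_vecAnn [Finite ι] {v : V} (hv : v ≠ 0) :
    ∃ w : V, w ≠ 0 ∧ vecAnn φ v ≤ vecAnn φ w ∧
      ∀ w' : V, w' ≠ 0 → vecAnn φ w ≤ vecAnn φ w' → vecAnn φ w' = vecAnn φ w := by
  obtain ⟨M, ⟨w, ⟨hw, hvw⟩, rfl⟩, hM⟩ := set_has_maximal_iff_noetherian.mpr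
    (inferInstance : IsNoetherian (MvPolynomial ι ℂ) (MvPolynomial ι ℂ))
    (vecAnn φ '' {w | w ≠ 0 ∧ vecAnn φ v ≤ vecAnn φ w}) ⟨_, v, ⟨hv, le_rfl⟩, rfl⟩
  refine ⟨w, hw, hvw, fun w' hw' hle => ?_⟩
  by_contra hne
  exact hM _ ⟨w', ⟨hw', hvw.trans hle⟩, rfl⟩ (lt_of_le_of_ne hle (Ne.symm hne))

/-- If a vector killed by a prime `P` is a sum of weight operators applied to a vector killed by
`P`, with `P` the annihilator of all nonzero vectors it kills, then only weights
stabilizing `P` contribute. -/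
lemma exists_stabilizer_sum [Finite ι] {P : Ideal (MvPolynomial ι ℂ)} (hP : P.IsPrime)
    (hPmax : ∀ w : V, w ≠ 0 → P ≤ vecAnn φ w → vecAnn φ w = P)
    {w w' : V} (hw : P ≤ vecAnn φ w) (hw' : P ≤ vecAnn φ w') {u : Module.End ℂ V}
    (hu : u ∈ weightAlgebra φ) (huw : u w' = w) :
    ∃ u' ∈ ⨆ l : {l : ι → ℂ // P.comap (translate l) = P}, weightOp φ l.1, u' w' = w := by
  classical
  obtain ⟨F, hF, rfl⟩ := (Submodule.mem_iSup_iff_exists_finsupp _ _).mp hu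
  have hann : ∀ l, ∀ f ∈ P.comap (translate l), φ f (F l w') = 0 := by
    intro l f hf
    rw [← Module.End.mul_apply, map_mul_weightOp (hF l), Module.End.mul_apply,
      mem_vecAnn.mp (hw' hf), map_zero]
  let A := F.support.filter fun l => P.comap (translate l) = P
  let B := F.support.filter fun l => ¬ P.comap (translate l) = P
  have hmemA : ∑ l ∈ A, F l ∈
      ⨆ l : {l : ι → ℂ // P.comap (translate l) = P}, weightOp φ l.1 :=
    sum_mem fun l hl => Submodule.mem_iSup_of_mem
      (⟨l, (Finset.mem_filter.mp hl).2⟩ : {l : ι → ℂ // P.comap (translate l) = P}) (hF l)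
  refine ⟨∑ l ∈ A, F l, hmemA, ?_⟩
  have hsplit : w = (∑ l ∈ A, F l) w' + (∑ l ∈ B, F l) w' := by
    rw [← huw, ← LinearMap.add_apply, Finset.sum_filter_add_sum_filter_not]
    rfl
  by_contra hne
  have hd : (∑ l ∈ B, F l) w' ≠ 0 := by
    intro h0
    rw [h0, add_zero] at hsplit
    exact hne hsplit.symm
  have hPd : P ≤ vecAnn φ ((∑ l ∈ B, F l) w') := by
    intro f hf
    have h1 : (∑ l ∈ B, F l) w' = w - (∑ l ∈ A, F l) w' := by rw [hsplit]; abel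
    rw [mem_vecAnn, h1, map_sub, mem_vecAnn.mp (hw hf), LinearMap.sum_apply, map_sum, zero_sub,
      neg_eq_zero]
    refine Finset.sum_eq_zero fun l hl => hann l f ?_
    rw [(Finset.mem_filter.mp hl).2]
    exact hf
  have hex : ∀ l : ι → ℂ, ∃ f, l ∈ B → f ∈ P.comap (translate l) ∧ f ∉ P := by
    intro l
    by_cases hl : l ∈ B
    · by_contra! hcon
      refine (Finset.mem_filter.mp hl).2 (comap_translate_eq_of_le fun f hf => ?_)
      exact (hcon f).2 hf
    · exact ⟨0, fun h => absurd h hl⟩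
  choose q hq using hex
  have h1 : ∏ l ∈ B, q l ∈ P := by
    rw [← hPmax _ hd hPd, mem_vecAnn, LinearMap.sum_apply, map_sum]
    refine Finset.sum_eq_zero fun l hl => hann l _ ?_
    exact Ideal.mem_of_dvd _ (Finset.dvd_prod_of_mem q hl) (hq l hl).1
  obtain ⟨l, hl, hlP⟩ := (hP.prod_mem_iff).mp h1
  exact (hq l hl).2 hlP

/-- Over a countable-dimensional space, operators `T - c` cannot all be invertible on the orbit of
a vector annihilated by no nonzero polynomial in `T`. -/
lemma exists_aeval_eq_zero_of_rank_le (hV : Module.rank ℂ V ≤ Cardinal.aleph0)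
    (T : Module.End ℂ V) (v : V) (h : ∀ c : ℂ, ∃ w : V, T w - c • w = v) :
    ∃ p : Polynomial ℂ, p ≠ 0 ∧ Polynomial.aeval T p v = 0 := by
  classical
  choose w hw using h
  have hnot : ¬ LinearIndependent ℂ w := by
    intro hli
    have h1 := hli.cardinal_lift_le_rank
    have h2 : Cardinal.lift.{0} (Module.rank ℂ V) ≤ Cardinal.aleph0 := by simpa using hV
    have h3 := h1.trans h2
    rw [Cardinal.lift_le_aleph0, Cardinal.mk_complex] at h3
    exact absurd h3 (not_le.mpr Cardinal.aleph0_lt_continuum)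
  rw [linearIndependent_iff'] at hnot
  push Not at hnot
  obtain ⟨s, a, hsum, c, hc, hac⟩ := hnot
  let q : ℂ → Polynomial ℂ := fun d => Polynomial.X - Polynomial.C d
  have hqw : ∀ d, Polynomial.aeval T (q d) (w d) = v := by
    intro d
    simp [q, hw, Module.algebraMap_end_apply]
  refine ⟨∑ d ∈ s, a d • ∏ e ∈ s.erase d, q e, ?_, ?_⟩
  · intro h0
    have h1 := congrArg (Polynomial.eval c) h0
    rw [Polynomial.eval_finsetSum, Finset.sum_eq_single c] at h1
    · rw [Polynomial.eval_smul, Polynomial.eval_prod, Polynomial.eval_zero, smul_eq_zero] at h1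
      rcases h1 with h1 | h1
      · exact hac h1
      · obtain ⟨e, he, he0⟩ := Finset.prod_eq_zero_iff.mp h1
        simp only [q, Polynomial.eval_sub, Polynomial.eval_X, Polynomial.eval_C] at he0
        exact (Finset.mem_erase.mp he).1 (sub_eq_zero.mp he0).symm
    · intro d hd hdc
      rw [Polynomial.eval_smul, Polynomial.eval_prod,
        Finset.prod_eq_zero (Finset.mem_erase.mpr ⟨hdc.symm, hc⟩) (by simp [q]), smul_zero]
    · intro h; exact absurd hc h
  · have : ∀ d ∈ s, Polynomial.aeval T (a d • ∏ e ∈ s.erase d, q e) v =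
        Polynomial.aeval T (∏ e ∈ s, q e) (a d • w d) := by
      intro d hd
      rw [← Finset.prod_erase_mul s q hd, map_smul, map_mul, LinearMap.smul_apply,
        Module.End.mul_apply, map_smul, hqw, map_smul]
    rw [map_sum, LinearMap.sum_apply, Finset.sum_congr rfl this, ← map_sum, hsum, map_zero]

/-- Structure theorem for torsion vectors: if sums of weight operators act transitively on nonzero
vectors and some nonzero polynomial kills a nonzero vector, then some nonzero linear
combination of the `φ (X i)` has an eigenvector. -/
theorem exists_eigenvector_of_torsion [Fintype ι] (hV : Module.rank ℂ V ≤ Cardinal.aleph0)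
    (htrans : ∀ w : V, w ≠ 0 → ∀ w' : V, ∃ u ∈ weightAlgebra φ, u w = w')
    {f : MvPolynomial ι ℂ} (hf : f ≠ 0) {v : V} (hv : v ≠ 0) (hfv : φ f v = 0) :
    ∃ a : ι → ℂ, a ≠ 0 ∧ ∃ w : V, w ≠ 0 ∧ ∃ c : ℂ, ∑ i, a i • φ (X i) w = c • w := by
  classical
  obtain ⟨w, hw, hvw, hmax⟩ := exists_maximal_vecAnn (φ := φ) hv
  have hP := vecAnn_isPrime hw hmax
  set P := vecAnn φ w with hPdef
  have hfP : f ∈ P := hvw hfv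
  let L : Set (ι → ℂ) := {l | P.comap (translate l) = P}
  have hL : Submodule.span ℂ L < ⊤ := by
    rw [lt_top_iff_ne_top]
    intro htop
    exact hf (eq_zero_of_translate_stable hP.ne_top htop (fun l hl => le_of_eq (Eq.symm hl)) hfP)
  obtain ⟨d, hd, hdL⟩ := Submodule.exists_le_ker_of_lt_top _ hL
  have hdsum : ∀ l : ι → ℂ, d l = ∑ i, l i * d (Pi.single i 1) := by
    intro l
    conv_lhs => rw [pi_eq_sum_univ' l, map_sum]
    refine Finset.sum_congr rfl fun i _ => ?_
    rw [map_smul, smul_eq_mul]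
  let ℓ : MvPolynomial ι ℂ := ∑ i, C (d (Pi.single i 1)) * X i
  have hφC : ∀ c : ℂ, φ (C c) = algebraMap ℂ _ c := fun c => φ.commutes c
  have hℓ : ∀ x : V, φ ℓ x = ∑ i, d (Pi.single i 1) • φ (X i) x := by
    intro x
    simp only [ℓ, map_sum, map_mul, hφC, LinearMap.sum_apply, Module.End.mul_apply,
      Module.algebraMap_end_apply]
  have hsub : ∀ c x, φ (ℓ - C c) x = φ ℓ x - c • x := by
    intro c x
    rw [map_sub, LinearMap.sub_apply, hφC, Module.algebraMap_end_apply]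
  have hcomm : ∀ u ∈ ⨆ l : {l : ι → ℂ // P.comap (translate l) = P}, weightOp φ l.1,
      φ ℓ * u = u * φ ℓ := by
    intro u hu
    induction hu using Submodule.iSup_induction' with
    | mem l u hu =>
      rw [map_mul_weightOp hu]
      congr 2
      have h0 : d l.1 = 0 := hdL (Submodule.subset_span l.2)
      have htC : ∀ c : ℂ, translate l.1 (C c) = C c := fun c => (translate l.1).commutes c
      simp only [ℓ, map_sum, map_mul, translate_X, htC, mul_add, Finset.sum_add_distrib]
      rw [add_eq_left]
      simp only [← C_mul, ← map_sum]
      rw [hdsum] at h0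
      simp only [mul_comm (d _)]
      rw [h0, C_0]
    | zero => rw [mul_zero, zero_mul]
    | add x y _ _ hx hy => rw [mul_add, add_mul, hx, hy]
  refine ⟨fun i => d (Pi.single i 1), ?_, w, hw, ?_⟩
  · intro h0
    refine hd (LinearMap.ext fun l => ?_)
    rw [hdsum, LinearMap.zero_apply]
    exact Finset.sum_eq_zero fun i _ => by
      rw [show d (Pi.single i 1) = 0 from congrFun h0 i, mul_zero]
  by_contra hcon
  have hnot : ∀ c : ℂ, ℓ - C c ∉ P := by
    intro c hc
    refine hcon ⟨c, ?_⟩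
    rw [← hℓ, ← sub_eq_zero, ← hsub]
    exact hc
  obtain ⟨p, hp0, hp⟩ := exists_aeval_eq_zero_of_rank_le hV (φ ℓ) w (fun c => by
    have h1 : φ (ℓ - C c) w ≠ 0 := hnot c
    have h2 : P ≤ vecAnn φ (φ (ℓ - C c) w) := by
      intro g hg
      rw [mem_vecAnn, map_apply_comm, mem_vecAnn.mp hg, map_zero]
    obtain ⟨u, hu, huw⟩ := htrans _ h1 w
    obtain ⟨u', hu', hw'⟩ := exists_stabilizer_sum hP hmax le_rfl h2 hu huw
    refine ⟨u' w, ?_⟩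
    rw [hsub, map_sub, map_smul, ← Module.End.mul_apply u', ← hcomm u' hu',
      Module.End.mul_apply] at hw'
    exact hw')
  have hpP : Polynomial.aeval ℓ p ∈ P := by
    rw [hPdef, mem_vecAnn, ← Polynomial.aeval_algHom_apply]
    exact hp
  rw [(IsAlgClosed.splits p).eq_prod_roots, map_mul, map_multiset_prod, Multiset.map_map] at hpP
  rcases hP.mem_or_mem hpP with h | h
  · rw [Polynomial.aeval_C] at h
    refine hP.ne_top (Ideal.eq_top_of_isUnit_mem _ h ?_)
    exact (isUnit_iff_ne_zero.mpr (Polynomial.leadingCoeff_ne_zero.mpr hp0)).map _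
  · obtain ⟨_, hx, hc⟩ := (hP.multiset_prod_mem_iff_exists_mem _).mp h
    obtain ⟨c, -, rfl⟩ := Multiset.mem_map.mp hx
    refine hnot c ?_
    simpa [MvPolynomial.algebraMap_eq] using hc

end WeightOperators

section LocallyFinite

attribute [local instance] LieRing.ofAssociativeRing

variable {V : Type*} [AddCommGroup V] [Module ℂ V]

/-- An operator is locally finite if every vector lies in a finite-dimensional stable subspace. -/
def LocFin (T : Module.End ℂ V) : Prop :=
  ∀ v, ∃ S : Submodule ℂ V, FiniteDimensional ℂ S ∧ v ∈ S ∧ ∀ w ∈ S, T w ∈ S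

/-- A (not necessarily finite-dimensional) diagonalizable operator. -/
def IsDiag (T : Module.End ℂ V) : Prop := ⨆ c, T.eigenspace c = ⊤

lemma IsDiag.induction {T : Module.End ℂ V} (h : IsDiag T) {p : V → Prop}
    (mem : ∀ (c : ℂ) (v : V), T v = c • v → p v) (zero : p 0)
    (add : ∀ v w, p v → p w → p (v + w)) (v : V) : p v := by
  have hv : v ∈ ⨆ c, T.eigenspace c := by rw [h]; trivial
  exact Submodule.iSup_induction _ (motive := p) hv
    (fun c v hv => mem c v (Module.End.mem_eigenspace_iff.mp hv)) zero add

lemma mem_iSup_eigenspace {T : Module.End ℂ V} {v : V} {c : ℂ} (h : T v = c • v) :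
    v ∈ ⨆ c, T.eigenspace c :=
  Submodule.mem_iSup_of_mem c (Module.End.mem_eigenspace_iff.mpr h)

lemma IsDiag.locFin {T : Module.End ℂ V} (h : IsDiag T) : LocFin T := by
  refine h.induction ?_ ?_ ?_
  · intro c v hv
    refine ⟨ℂ ∙ v, inferInstance, Submodule.mem_span_singleton_self v, fun w hw => ?_⟩
    obtain ⟨a, rfl⟩ := Submodule.mem_span_singleton.mp hw
    rw [map_smul, hv]
    exact Submodule.smul_mem _ _ (Submodule.smul_mem _ _ (Submodule.mem_span_singleton_self v))
  · exact ⟨⊥, inferInstance, zero_mem _, fun w hw => by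
      rw [(Submodule.mem_bot ℂ).mp hw, map_zero]; exact zero_mem _⟩
  · rintro v w ⟨S, hS, hv, hST⟩ ⟨S', hS', hw, hST'⟩
    refine ⟨S ⊔ S', inferInstance, Submodule.add_mem_sup hv hw, fun x hx => ?_⟩
    obtain ⟨y, hy, z, hz, rfl⟩ := Submodule.mem_sup.mp hx
    rw [map_add]
    exact Submodule.add_mem_sup (hST y hy) (hST' z hz)

lemma LocFin.exists_eigenvector {T : Module.End ℂ V} (h : LocFin T) [Nontrivial V] :
    ∃ v : V, v ≠ 0 ∧ ∃ c : ℂ, T v = c • v := by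
  obtain ⟨v, hv⟩ := exists_ne (0 : V)
  obtain ⟨S, hS, hvS, hST⟩ := h v
  have : Nontrivial S := ⟨⟨⟨v, hvS⟩, 0, fun h => hv (congrArg Subtype.val h)⟩⟩
  obtain ⟨c, hc⟩ := Module.End.exists_eigenvalue (T.restrict hST)
  obtain ⟨w, hw⟩ := hc.exists_hasEigenvector
  refine ⟨w, fun h => hw.2 (Subtype.ext h), c, ?_⟩
  exact congrArg Subtype.val hw.apply_eq_smul

/-- A function of a diagonalizable operator. -/
lemma IsDiag.exists_scaling {T : Module.End ℂ V} (h : IsDiag T) (F : ℂ → ℂ) :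
    ∃ s : Module.End ℂ V, ∀ c v, T v = c • v → s v = F c • v := by
  classical
  have hdec := DirectSum.isInternal_submodule_of_iSupIndep_of_iSup_eq_top
    T.eigenspaces_iSupIndep h
  let e := LinearEquiv.ofBijective (DirectSum.coeLinearMap T.eigenspace) hdec
  refine ⟨DirectSum.toModule ℂ ℂ V (fun c => F c • (T.eigenspace c).subtype) ∘ₗ
    e.symm.toLinearMap, fun c v hv => ?_⟩
  have hmem : v ∈ T.eigenspace c := Module.End.mem_eigenspace_iff.mpr hv
  have : e.symm v = DirectSum.lof ℂ ℂ (fun c => T.eigenspace c) c ⟨v, hmem⟩ := by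
    rw [LinearEquiv.symm_apply_eq]
    exact (DirectSum.coeLinearMap_lof T.eigenspace c ⟨v, hmem⟩).symm
  rw [LinearMap.comp_apply, LinearEquiv.coe_coe, this, DirectSum.toModule_lof]
  rfl

variable {g : Type*} [LieRing g] [LieAlgebra ℂ g]

lemma rep_comm (π : g →ₗ⁅ℂ⁆ Module.End ℂ V) (x y : g) (v : V) :
    π x (π y v) = π y (π x v) + π ⁅x, y⁆ v := by
  rw [LieHom.map_lie, Ring.lie_def, LinearMap.sub_apply, Module.End.mul_apply,
    Module.End.mul_apply]
  abel

/-- In an irreducible representation, an `ad`-diagonalizable element with an eigenvector acts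
diagonalizably. -/
lemma isDiag_of_eigenvector {π : g →ₗ⁅ℂ⁆ Module.End ℂ V}
    (hirr : ∀ N : Submodule ℂ V, (∀ x, ∀ v ∈ N, π x v ∈ N) → N = ⊥ ∨ N = ⊤)
    {y : g} (hy : IsDiag (LieAlgebra.ad ℂ g y)) {v : V} (hv : v ≠ 0) {c : ℂ}
    (hvc : π y v = c • v) : IsDiag (π y) := by
  refine (hirr (⨆ c, (π y).eigenspace c) fun z w hw => ?_).resolve_left fun h => ?_
  · induction hw using Submodule.iSup_induction' with
    | mem a w hw =>
      rw [Module.End.mem_eigenspace_iff] at hw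
      refine hy.induction (p := fun z => π z w ∈ ⨆ c, (π y).eigenspace c) ?_ ?_ ?_ z
      · intro b z hz
        rw [LieAlgebra.ad_apply] at hz
        refine mem_iSup_eigenspace (c := a + b) ?_
        rw [rep_comm, hz, hw, map_smul, map_smul, LinearMap.smul_apply, add_smul]
      · rw [map_zero, LinearMap.zero_apply]; exact zero_mem _
      · intro x x' hx hx'
        rw [map_add, LinearMap.add_apply]; exact add_mem hx hx'
    | zero => rw [map_zero]; exact zero_mem _
    | add x x' _ _ hx hx' => rw [map_add]; exact add_mem hx hx'
  · have := mem_iSup_eigenspace hvc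
    rw [h] at this
    exact hv ((Submodule.mem_bot ℂ).mp this)

/-- Elements acting diagonalizably both in the adjoint representation and through `π`. -/
def diagSet (π : g →ₗ⁅ℂ⁆ Module.End ℂ V) : Set g :=
  {y | IsDiag (LieAlgebra.ad ℂ g y) ∧ IsDiag (π y)}

lemma isDiag_conj {π : g →ₗ⁅ℂ⁆ Module.End ℂ V} {y w : g} (hy : IsDiag (LieAlgebra.ad ℂ g y))
    (hπy : IsDiag (π y)) (hw : IsDiag (π w)) {t : ℂ} {σ : Module.End ℂ g}
    (hσ : ∀ c z, ⁅y, z⁆ = c • z → σ z = Complex.exp (t * c) • z) : IsDiag (π (σ w)) := by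
  obtain ⟨s, hs⟩ := hπy.exists_scaling fun c => Complex.exp (t * c)
  obtain ⟨s', hs'⟩ := hπy.exists_scaling fun c => Complex.exp (-(t * c))
  have hss' : ∀ v, s (s' v) = v := by
    refine hπy.induction ?_ ?_ ?_
    · intro c v hv
      rw [hs' c v hv, map_smul, hs c v hv, smul_smul, ← Complex.exp_add, neg_add_cancel,
        Complex.exp_zero, one_smul]
    · rw [map_zero, map_zero]
    · intro v w hv hw; rw [map_add, map_add, hv, hw]
  have hconj : ∀ z v, π (σ z) (s v) = s (π z v) := by
    intro z v
    refine hy.induction (p := fun z => π (σ z) (s v) = s (π z v)) ?_ ?_ ?_ z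
    · intro b z hz
      rw [LieAlgebra.ad_apply] at hz
      refine hπy.induction (p := fun v => π (σ z) (s v) = s (π z v)) ?_ ?_ ?_ v
      · intro c v hv
        have h1 : π y (π z v) = (c + b) • π z v := by
          rw [rep_comm, hz, hv, map_smul, map_smul, LinearMap.smul_apply, add_smul]
        rw [hs _ _ h1, hs _ _ hv, hσ _ _ hz, map_smul, map_smul, LinearMap.smul_apply, smul_smul,
          ← Complex.exp_add, mul_add]
      · simp only [map_zero]
      · intro v w hv hw; simp only [map_add, hv, hw]
    · simp only [map_zero, LinearMap.zero_apply]
    · intro v w hv hw; simp only [map_add, LinearMap.add_apply, hv, hw]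
  refine top_le_iff.mp fun v _ => ?_
  rw [← hss' v]
  refine hw.induction (p := fun v => s v ∈ ⨆ c, (π (σ w)).eigenspace c) ?_ ?_ ?_ (s' v)
  · intro c v hv
    refine mem_iSup_eigenspace (c := c) ?_
    rw [hconj, hv, map_smul]
  · rw [map_zero]; exact zero_mem _
  · intro x x' hx hx'
    rw [map_add]; exact add_mem hx hx'

/-- The span of `diagSet π` is closed under brackets. -/
lemma lie_mem_span_diagSet {π : g →ₗ⁅ℂ⁆ Module.End ℂ V} {y w : g} (hy : y ∈ diagSet π)
    (hw : w ∈ diagSet π) : ⁅y, w⁆ ∈ Submodule.span ℂ (diagSet π) := by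
  by_contra hnot
  obtain ⟨ℓ, hℓ, hker⟩ := Submodule.exists_le_ker_of_notMem hnot
  choose σ hσ using fun t : ℂ => hy.1.exists_scaling fun c => Complex.exp (t * c)
  have h0 : ∀ t, ℓ (σ t w) = 0 := fun t => hker <| Submodule.subset_span
    ⟨isDiag_conj hy.1 hy.1 hw.1 (hσ t), isDiag_conj hy.1 hy.2 hw.2 (hσ t)⟩
  have hderiv : ∀ z, HasDerivAt (fun t => ℓ (σ t z)) (ℓ ⁅y, z⁆) 0 := by
    refine hy.1.induction ?_ ?_ ?_
    · intro c z hz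
      have h1 : (fun t => ℓ (σ t z)) = fun t => Complex.exp (t * c) * ℓ z := by
        funext t
        rw [hσ t c z hz, map_smul, smul_eq_mul]
      rw [LieAlgebra.ad_apply] at hz
      rw [h1, hz, map_smul, smul_eq_mul]
      have h2 : HasDerivAt (fun t : ℂ => t * c) c 0 := by
        simpa using (hasDerivAt_id (0 : ℂ)).mul_const c
      simpa using h2.cexp.mul_const (ℓ z)
    · simpa using hasDerivAt_const (0 : ℂ) (0 : ℂ)
    · intro z z' hz hz'
      simp only [map_add, lie_add]
      exact hz.add hz'
  have h1 := hderiv w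
  rw [show (fun t => ℓ (σ t w)) = fun _ => 0 from funext h0] at h1
  exact hℓ (h1.unique (hasDerivAt_const _ _))

lemma exists_stable_of_list {α : Type*} {ρ : α → Module.End ℂ V} {L : List α}
    (hL : ∀ x ∈ L, LocFin (ρ x)) (S : Submodule ℂ V) [FiniteDimensional ℂ S] :
    ∃ S' : Submodule ℂ V, FiniteDimensional ℂ S' ∧
      ∀ a : α → ℕ, ∀ v ∈ S, (L.map fun x => ρ x ^ a x).prod v ∈ S' := by
  induction L with
  | nil => exact ⟨S, inferInstance, fun a v hv => by simpa using hv⟩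
  | cons x L ih =>
    set T := ρ x
    obtain ⟨S₁, h₁, hS₁⟩ := ih fun T' hT' => hL T' (List.mem_cons_of_mem _ hT')
    obtain ⟨s, hs⟩ : S₁.FG := Module.Finite.iff_fg.mp h₁
    choose F hFfin hvF hF using hL x List.mem_cons_self
    have hle : S₁ ≤ ⨆ v ∈ s, F v := by
      rw [← hs, Submodule.span_le]
      exact fun v hv => Submodule.mem_iSup_of_mem v (Submodule.mem_iSup_of_mem hv (hvF v))
    have hT : ∀ w ∈ ⨆ v ∈ s, F v, T w ∈ ⨆ v ∈ s, F v := by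
      have : ⨆ v ∈ s, F v ≤ (⨆ v ∈ s, F v).comap T :=
        iSup₂_le fun v hv w hw =>
          Submodule.mem_iSup_of_mem v (Submodule.mem_iSup_of_mem hv (hF v w hw))
      exact this
    refine ⟨⨆ v ∈ s, F v, ?_, fun a v hv => ?_⟩
    · exact Submodule.finiteDimensional_finset_sup s F |> fun h => by
        rwa [Finset.sup_eq_iSup] at h
    · rw [List.map_cons, List.prod_cons, Module.End.mul_apply]
      generalize a x = n
      induction n with
      | zero => exact hle (hS₁ a v hv)
      | succ n ihn =>
        rw [pow_succ', Module.End.mul_apply]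
        exact hT _ ihn

/-- Monomials of degree less than `d` in elements of `s`. -/
def monomialSpan (π : g →ₗ⁅ℂ⁆ Module.End ℂ V) (s : Set g) (v : V) (d : ℕ) : Submodule ℂ V :=
  Submodule.span ℂ {w | ∃ l : List g, (∀ x ∈ l, x ∈ s) ∧ l.length < d ∧ (l.map π).prod v = w}

lemma monomialSpan_mono (π : g →ₗ⁅ℂ⁆ Module.End ℂ V) (s : Set g) (v : V) {d e : ℕ} (h : d ≤ e) :
    monomialSpan π s v d ≤ monomialSpan π s v e :=
  Submodule.span_mono fun _ ⟨l, hl, hd, hw⟩ => ⟨l, hl, hd.trans_le h, hw⟩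

lemma apply_mem_monomialSpan {π : g →ₗ⁅ℂ⁆ Module.End ℂ V} {s : Set g} {v : V} {d : ℕ} {x : g}
    (hx : x ∈ Submodule.span ℂ s) {w : V} (hw : w ∈ monomialSpan π s v d) :
    π x w ∈ monomialSpan π s v (d + 1) := by
  induction hw using Submodule.span_induction with
  | mem w hw =>
    obtain ⟨l, hl, hd, rfl⟩ := hw
    induction hx using Submodule.span_induction with
    | mem x hx =>
      refine Submodule.subset_span ⟨x :: l, ?_, by simpa using hd, by simp⟩
      exact List.forall_mem_cons.mpr ⟨hx, hl⟩
    | zero => rw [map_zero, LinearMap.zero_apply]; exact zero_mem _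
    | add x y _ _ hx hy => rw [map_add, LinearMap.add_apply]; exact add_mem hx hy
    | smul c x _ hx => rw [map_smul, LinearMap.smul_apply]; exact Submodule.smul_mem _ _ hx
  | zero => rw [map_zero]; exact zero_mem _
  | add x y _ _ hx hy => rw [map_add]; exact add_mem hx hy
  | smul c x _ hx => rw [map_smul]; exact Submodule.smul_mem _ _ hx

lemma prod_sub_prod_mem_of_perm {π : g →ₗ⁅ℂ⁆ Module.End ℂ V} {s : Set g}
    (hs : ∀ x ∈ s, ∀ y ∈ s, ⁅x, y⁆ ∈ Submodule.span ℂ s) (v : V) {l l' : List g}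
    (h : l.Perm l') (hl : ∀ x ∈ l, x ∈ s) :
    (l.map π).prod v - (l'.map π).prod v ∈ monomialSpan π s v l.length := by
  induction h with
  | nil => simp
  | cons x h ih =>
    rw [List.forall_mem_cons] at hl
    have := apply_mem_monomialSpan (Submodule.subset_span hl.1) (ih hl.2)
    simpa only [List.map_cons, List.prod_cons, Module.End.mul_apply, List.length_cons,
      map_sub] using this
  | swap x y l =>
    rw [List.forall_mem_cons, List.forall_mem_cons] at hl
    have h1 : (l.map π).prod v ∈ monomialSpan π s v (l.length + 1) :=
      Submodule.subset_span ⟨l, hl.2.2, Nat.lt_succ_self _, rfl⟩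
    have h2 := apply_mem_monomialSpan (hs y hl.1 x hl.2.1) h1
    simp only [List.map_cons, List.prod_cons, Module.End.mul_apply, List.length_cons]
    rw [rep_comm π y x, add_sub_cancel_left]
    exact h2
  | trans h₁ h₂ ih₁ ih₂ =>
    have := add_mem (ih₁ hl) (h₁.length_eq ▸ ih₂ fun x hx => hl x (h₁.mem_iff.mpr hx))
    rwa [sub_add_sub_cancel] at this

/-- If a finite-dimensional subalgebra is spanned by elements acting locally finitely, all its
elements act locally finitely. -/
lemma locFin_of_mem_span [FiniteDimensional ℂ g] {π : g →ₗ⁅ℂ⁆ Module.End ℂ V} {s : Set g}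
    (hs : ∀ x ∈ s, ∀ y ∈ s, ⁅x, y⁆ ∈ Submodule.span ℂ s) (hfin : ∀ x ∈ s, LocFin (π x)) {x : g}
    (hx : x ∈ Submodule.span ℂ s) : LocFin (π x) := by
  classical
  obtain ⟨t, hts, ht⟩ := (Submodule.fg_span_iff_fg_span_finset_subset s).mp
    (IsNoetherian.noetherian (Submodule.span ℂ s))
  rw [ht] at hx
  have hst : ∀ x ∈ t, ∀ y ∈ t, ⁅x, y⁆ ∈ Submodule.span ℂ (t : Set g) :=
    fun x hx y hy => ht ▸ hs x (hts hx) y (hts hy)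
  intro v
  obtain ⟨S, hS, hmem⟩ := exists_stable_of_list (ρ := π) (L := t.toList)
    (fun x hx => hfin x (hts (Finset.mem_toList.mp hx))) (ℂ ∙ v)
  have hle : ∀ d, monomialSpan π t v d ≤ S := by
    intro d
    induction d with
    | zero =>
      refine Submodule.span_le.mpr ?_
      rintro _ ⟨l, _, h, _⟩
      exact absurd h (Nat.not_lt_zero _)
    | succ d ih =>
      refine Submodule.span_le.mpr ?_
      rintro _ ⟨l, hl, hld, rfl⟩
      let l' := t.toList.flatMap fun x => List.replicate (l.count x) x
      have hperm : l.Perm l' := by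
        rw [List.perm_iff_count]
        intro y
        rw [List.count_flatMap]
        have : List.count y ∘ (fun x => List.replicate (l.count x) x) =
            fun x => if x = y then l.count x else 0 := by
          funext x
          simp [List.count_replicate]
        rw [this, Finset.sum_map_toList, Finset.sum_ite_eq']
        split_ifs with hy
        · rfl
        · exact List.count_eq_zero.mpr fun h => hy (hl y h)
      have h1 := ih (monomialSpan_mono π t v (Nat.le_of_lt_succ hld)
        (prod_sub_prod_mem_of_perm hst v hperm hl))
      have h2 : (l'.map π).prod = (t.toList.map fun x => π x ^ l.count x).prod := by
        simp only [l']
        generalize t.toList = L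
        induction L with
        | nil => rfl
        | cons x L ihL => simp [ihL]
      have h3 := hmem (fun x => l.count x) v (Submodule.mem_span_singleton_self v)
      rw [← h2] at h3
      simpa using add_mem h1 h3
  have hle' : ⨆ d, monomialSpan π t v d ≤ S := iSup_le hle
  refine ⟨⨆ d, monomialSpan π t v d, Submodule.finiteDimensional_of_le hle', ?_, ?_⟩
  · exact Submodule.mem_iSup_of_mem 1 (Submodule.subset_span ⟨[], by simp, by simp, by simp⟩)
  · have : ⨆ d, monomialSpan π t v d ≤ (⨆ d, monomialSpan π t v d).comap (π x) :=
      iSup_le fun d w hw => Submodule.mem_iSup_of_mem (d + 1) (apply_mem_monomialSpan hx hw)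
    exact this

lemma lie_mem_span {s : Set g} (hs : ∀ x ∈ s, ∀ y ∈ s, ⁅x, y⁆ ∈ Submodule.span ℂ s) {x y : g}
    (hx : x ∈ Submodule.span ℂ s) (hy : y ∈ Submodule.span ℂ s) :
    ⁅x, y⁆ ∈ Submodule.span ℂ s := by
  induction hx using Submodule.span_induction with
  | mem x hx =>
    induction hy using Submodule.span_induction with
    | mem y hy => exact hs x hx y hy
    | zero => rw [lie_zero]; exact zero_mem _
    | add a b _ _ ha hb => rw [lie_add]; exact add_mem ha hb
    | smul c a _ ha => rw [lie_smul]; exact Submodule.smul_mem _ _ ha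
  | zero => rw [zero_lie]; exact zero_mem _
  | add a b _ _ ha hb => rw [add_lie]; exact add_mem ha hb
  | smul c a _ ha => rw [smul_lie]; exact Submodule.smul_mem _ _ ha

/-- The subalgebra spanned by `diagSet π`. -/
def diagSubalgebra (π : g →ₗ⁅ℂ⁆ Module.End ℂ V) : LieSubalgebra ℂ g where
  __ := Submodule.span ℂ (diagSet π)
  lie_mem' := lie_mem_span fun _ hx _ hy => lie_mem_span_diagSet hx hy

lemma locFin_of_mem_diagSubalgebra [FiniteDimensional ℂ g] {π : g →ₗ⁅ℂ⁆ Module.End ℂ V} {x : g}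
    (hx : x ∈ diagSubalgebra π) : LocFin (π x) :=
  locFin_of_mem_span (s := diagSet π) (fun _ hx _ hy => lie_mem_span_diagSet hx hy)
    (fun _ hx => hx.2.locFin) hx

/-- The eigenvectors of a diagonalizable `ad x` for nonzero eigenvalues generate an ideal. -/
lemma exists_ideal_le {x : g} (hx : IsDiag (LieAlgebra.ad ℂ g x)) {h : LieSubalgebra ℂ g}
    (hh : ∀ (c : ℂ) (z : g), c ≠ 0 → ⁅x, z⁆ = c • z → z ∈ h) (hxc : ∃ z : g, ⁅x, z⁆ ≠ 0) :
    ∃ I : LieIdeal ℂ g, I ≠ ⊥ ∧ ∀ z ∈ I, z ∈ h := by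
  let s : Set g := {z | ∃ c : ℂ, c ≠ 0 ∧ ⁅x, z⁆ = c • z}
  have key : ∀ z w : g, w ∈ LieSubalgebra.lieSpan ℂ g s → ⁅z, w⁆ ∈ LieSubalgebra.lieSpan ℂ g s := by
    intro z w hw
    refine hx.induction (p := fun z => ⁅z, w⁆ ∈ LieSubalgebra.lieSpan ℂ g s) ?_ ?_ ?_ z
    · intro c z hz
      rw [LieAlgebra.ad_apply] at hz
      by_cases hc : c = 0
      · rw [hc, zero_smul] at hz
        induction hw using LieSubalgebra.lieSpan_induction with
        | mem w hw =>
          obtain ⟨b, hb, hw⟩ := hw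
          refine LieSubalgebra.subset_lieSpan ⟨b, hb, ?_⟩
          rw [leibniz_lie, hz, zero_lie, zero_add, hw, lie_smul]
        | zero => rw [lie_zero]; exact zero_mem _
        | add a b _ _ ha hb => rw [lie_add]; exact add_mem ha hb
        | smul c a _ ha => rw [lie_smul]; exact (LieSubalgebra.lieSpan ℂ g s).smul_mem c ha
        | lie a b ha' hb' ha hb =>
          rw [leibniz_lie]
          exact add_mem (LieSubalgebra.lie_mem _ ha hb') (LieSubalgebra.lie_mem _ ha' hb)
      · exact LieSubalgebra.lie_mem _ (LieSubalgebra.subset_lieSpan ⟨c, hc, hz⟩) hw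
    · rw [zero_lie]; exact zero_mem _
    · intro a b ha hb
      rw [add_lie]; exact add_mem ha hb
  let I : LieIdeal ℂ g :=
    { (LieSubalgebra.lieSpan ℂ g s).toSubmodule with lie_mem := fun {z w} hw => key z w hw }
  have hIs : ∀ z ∈ s, z ∈ I := fun z hz => LieSubalgebra.subset_lieSpan hz
  refine ⟨I, fun hbot => ?_, fun z hz => ?_⟩
  · obtain ⟨z, hz⟩ := hxc
    refine hz (hx.induction (p := fun z => ⁅x, z⁆ = 0) ?_ (lie_zero x) ?_ z)
    · intro c z hz
      rw [LieAlgebra.ad_apply] at hz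
      by_cases hc : c = 0
      · rw [hz, hc, zero_smul]
      · have := hIs z ⟨c, hc, hz⟩
        rw [hbot, LieSubmodule.mem_bot] at this
        rw [this, lie_zero]
    · intro a b ha hb
      rw [lie_add, ha, hb, add_zero]
  · have : LieSubalgebra.lieSpan ℂ g s ≤ h :=
      LieSubalgebra.lieSpan_le.mpr fun z ⟨c, hc, hz⟩ => hh c z hc hz
    exact this hz

lemma rank_le_aleph0 [FiniteDimensional ℂ g] {π : g →ₗ⁅ℂ⁆ Module.End ℂ V}
    (hirr : ∀ N : Submodule ℂ V, (∀ x, ∀ v ∈ N, π x v ∈ N) → N = ⊥ ∨ N = ⊤) :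
    Module.rank ℂ V ≤ Cardinal.aleph0 := by
  rcases subsingleton_or_nontrivial V with _ | _
  · simp [rank_subsingleton']
  obtain ⟨v, hv⟩ := exists_ne (0 : V)
  let b := Module.finBasis ℂ g
  let m : List (Fin (Module.finrank ℂ g)) → V := fun l => (l.map fun i => π (b i)).prod v
  have hm : v ∈ Submodule.span ℂ (Set.range m) := Submodule.subset_span ⟨[], by simp [m]⟩
  have htop : Submodule.span ℂ (Set.range m) = ⊤ := by
    refine (hirr _ fun x w hw => ?_).resolve_left fun h => hv ?_
    · have hb : ∀ i, π (b i) w ∈ Submodule.span ℂ (Set.range m) := by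
        intro i
        induction hw using Submodule.span_induction with
        | mem w hw =>
          obtain ⟨l, rfl⟩ := hw
          exact Submodule.subset_span ⟨i :: l, by simp [m]⟩
        | zero => rw [map_zero]; exact zero_mem _
        | add x y _ _ hx hy => rw [map_add]; exact add_mem hx hy
        | smul c x _ hx => rw [map_smul]; exact Submodule.smul_mem _ _ hx
      rw [← b.sum_repr x, map_sum, LinearMap.sum_apply]
      refine sum_mem fun i _ => ?_
      rw [map_smul, LinearMap.smul_apply]
      exact Submodule.smul_mem _ _ (hb i)
    · rw [h] at hm
      exact (Submodule.mem_bot ℂ).mp hm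
  rw [← rank_top, ← htop]
  exact (rank_span_le _).trans (Cardinal.mk_le_aleph0_iff.mpr (Set.countable_range m))

/-- Torsion vectors in an irreducible representation produce a nonzero combination of
commuting simultaneously diagonalizable elements acting with an eigenvector. -/
lemma exists_eigenvector_of_rep_torsion [FiniteDimensional ℂ g] {ι : Type*} [Fintype ι]
    {π : g →ₗ⁅ℂ⁆ Module.End ℂ V}
    (hirr : ∀ N : Submodule ℂ V, (∀ x, ∀ v ∈ N, π x v ∈ N) → N = ⊥ ∨ N = ⊤)
    {b : ι → g} (hb : ⨆ χ : ι → ℂ, ⨅ i, (LieAlgebra.ad ℂ g (b i)).eigenspace (χ i) = ⊤)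
    {φ : MvPolynomial ι ℂ →ₐ[ℂ] Module.End ℂ V} (hφ : ∀ i, φ (X i) = π (b i))
    {f : MvPolynomial ι ℂ} (hf : f ≠ 0) {v : V} (hv : v ≠ 0) (hfv : φ f v = 0) :
    ∃ a : ι → ℂ, a ≠ 0 ∧ ∃ w : V, w ≠ 0 ∧ ∃ c : ℂ, π (∑ i, a i • b i) w = c • w := by
  have hπ : ∀ z, π z ∈ weightAlgebra φ := by
    intro z
    have hz : z ∈ ⨆ χ : ι → ℂ, ⨅ i, (LieAlgebra.ad ℂ g (b i)).eigenspace (χ i) := by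
      rw [hb]; trivial
    induction hz using Submodule.iSup_induction' with
    | mem χ z hz =>
      refine Submodule.mem_iSup_of_mem χ fun i => ?_
      have h1 := Module.End.mem_eigenspace_iff.mp ((Submodule.mem_iInf _).mp hz i)
      rw [LieAlgebra.ad_apply] at h1
      rw [hφ, ← map_smul, ← h1, LieHom.map_lie, Ring.lie_def]
      abel
    | zero => rw [map_zero]; exact zero_mem _
    | add x y _ _ hx hy => rw [map_add]; exact add_mem hx hy
  have htrans : ∀ w : V, w ≠ 0 → ∀ w' : V, ∃ u ∈ weightAlgebra φ, u w = w' := by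
    intro w hw
    let N : Submodule ℂ V :=
      (Subalgebra.toSubmodule (weightAlgebra φ)).map (LinearMap.applyₗ w)
    have hN : ∀ w', w' ∈ N ↔ ∃ u ∈ weightAlgebra φ, u w = w' := fun w' => Iff.rfl
    have htop : N = ⊤ := by
      refine (hirr N fun x w' hw' => ?_).resolve_left fun h => hw ?_
      · rw [hN] at hw' ⊢
        obtain ⟨u, hu, rfl⟩ := hw'
        exact ⟨π x * u, mul_mem (hπ x) hu, rfl⟩
      · have : w ∈ N := (hN w).mpr ⟨1, one_mem _, rfl⟩
        rw [h] at this
        exact (Submodule.mem_bot ℂ).mp this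
    intro w'
    rw [← hN, htop]
    trivial
  obtain ⟨a, ha, w, hw, c, hc⟩ :=
    exists_eigenvector_of_torsion (rank_le_aleph0 hirr) htrans hf hv hfv
  refine ⟨a, ha, w, hw, c, ?_⟩
  rw [← hc, map_sum, LinearMap.sum_apply]
  exact Finset.sum_congr rfl fun i _ => by rw [map_smul, LinearMap.smul_apply, hφ]

end LocallyFinite

section Cartan

attribute [local instance] LieRing.ofAssociativeRing

variable {gR : Type*} [LieRing gR] [LieAlgebra ℝ gR] {θ : gR →ₗ⁅ℝ⁆ gR}

lemma killingForm_apply_involution (hinv : ∀ x, θ (θ x) = x) (x y : gR) :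
    killingForm ℝ gR (θ x) (θ y) = killingForm ℝ gR x y :=
  LieAlgebra.killingForm_of_equiv_apply
    ({ θ with invFun := θ, left_inv := hinv, right_inv := hinv } : gR ≃ₗ⁅ℝ⁆ gR) x y

lemma killingForm_lie_right (x y z : gR) :
    killingForm ℝ gR x ⁅y, z⁆ = -killingForm ℝ gR ⁅y, x⁆ z := by
  rw [← lie_skew y x, map_neg, LinearMap.neg_apply, neg_neg]
  exact (LieModule.traceForm_apply_lie_apply ℝ gR gR x y z).symm

lemma ad_tmul (y : gR) :
    LieAlgebra.ad ℂ (ℂ ⊗[ℝ] gR) (1 ⊗ₜ[ℝ] y) = (LieAlgebra.ad ℝ gR y).baseChange ℂ :=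
  LieModule.toEnd_baseChange ℝ ℂ gR gR y

/-- The center of a Lie algebra with a definite Cartan involution is trivial. -/
lemma eq_zero_of_lie_eq_zero
    (hneg : ∀ x : gR, x ≠ 0 → killingForm ℝ gR x (θ x) < 0) {x : gR}
    (hx : ∀ z w : gR, killingForm ℝ gR ⁅x, z⁆ w = 0) : x = 0 := by
  have h1 : ∀ z : gR, ⁅x, z⁆ = 0 := by
    intro z
    by_contra h
    exact (hneg _ h).ne (hx _ _)
  have h2 : LieAlgebra.ad ℝ gR x = 0 := LinearMap.ext h1
  by_contra h
  refine (hneg x h).ne ?_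
  rw [killingForm_apply_apply, h2, LinearMap.zero_comp, map_zero]

lemma isSemisimple_baseChange {M : Type*} [AddCommGroup M] [Module ℝ M] [FiniteDimensional ℝ M]
    {T : Module.End ℝ M} (hT : T.IsSemisimple) :
    Module.End.IsSemisimple (T.baseChange ℂ) := by
  refine Module.End.isSemisimple_of_squarefree_aeval_eq_zero
    (p := (minpoly ℝ T).map (algebraMap ℝ ℂ)) ?_ ?_
  · exact (PerfectField.separable_iff_squarefree.mpr hT.minpoly_squarefree).map.squarefree
  · rw [Polynomial.aeval_map_algebraMap]
    have := Polynomial.aeval_algHom_apply (Module.End.baseChangeHom ℝ ℂ M) T (minpoly ℝ T)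
    rw [minpoly.aeval, map_zero] at this
    exact this

/-- Complex combinations of linearly independent real vectors are not central. -/
lemma exists_lie_ne_zero
    (hneg : ∀ x : gR, x ≠ 0 → killingForm ℝ gR x (θ x) < 0) {ι : Type*} [Fintype ι] {y : ι → gR}
    (hy : LinearIndependent ℝ y) {a : ι → ℂ} (ha : a ≠ 0) :
    ∃ z : ℂ ⊗[ℝ] gR, ⁅∑ i, a i • (1 : ℂ) ⊗ₜ[ℝ] y i, z⁆ ≠ 0 := by
  by_contra! h
  have h0 : ∀ z w : gR, ∑ i, a i * (killingForm ℝ gR ⁅y i, z⁆ w : ℂ) = 0 := by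
    intro z w
    let F : gR →ₗ[ℝ] ℝ := (killingForm ℝ gR).flip w
    have h1 := congrArg (TensorProduct.rid ℝ ℂ ∘ F.lTensor ℂ) (h (1 ⊗ₜ z))
    simpa [F, LieAlgebra.ExtendScalars.bracket_tmul, TensorProduct.smul_tmul', mul_comm,
      sum_lie] using h1
  have hre : ∑ i, (a i).re • y i = 0 := by
    refine eq_zero_of_lie_eq_zero hneg fun z w => ?_
    have h1 := congrArg Complex.re (h0 z w)
    simpa [sum_lie] using h1
  have him : ∑ i, (a i).im • y i = 0 := by
    refine eq_zero_of_lie_eq_zero hneg fun z w => ?_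
    have h1 := congrArg Complex.im (h0 z w)
    simpa [sum_lie] using h1
  rw [Fintype.linearIndependent_iff] at hy
  exact ha (funext fun i => Complex.ext (hy _ hre i) (hy _ him i))

lemma baseChange_lie {R A L : Type*} [CommRing R] [CommRing A] [Algebra R A] [LieRing L]
    [LieAlgebra R L] (θ : L →ₗ⁅R⁆ L) (x z : A ⊗[R] L) :
    (θ : L →ₗ[R] L).baseChange A ⁅x, z⁆ =
      ⁅(θ : L →ₗ[R] L).baseChange A x, (θ : L →ₗ[R] L).baseChange A z⁆ := by
  induction x with
  | zero => simp
  | add x y hx hy => rw [add_lie, map_add, map_add, add_lie, hx, hy]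
  | tmul a x =>
    induction z with
    | zero => simp
    | add x y hx hy => rw [lie_add, map_add, map_add, lie_add, hx, hy]
    | tmul b z => simp [LieAlgebra.ExtendScalars.bracket_tmul]

/-- The complexification of a linear involution, up to the identity, has values in `h` as soon as
the fixed points of the involution do. -/
lemma add_baseChange_mem {h : Submodule ℂ (ℂ ⊗[ℝ] gR)} (hinv : ∀ x, θ (θ x) = x)
    (hh : ∀ y : gR, θ y = y → (1 : ℂ) ⊗ₜ[ℝ] y ∈ h) (z : ℂ ⊗[ℝ] gR) :
    z + (θ : gR →ₗ[ℝ] gR).baseChange ℂ z ∈ h := by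
  induction z with
  | zero => rw [map_zero, add_zero]; exact zero_mem _
  | add x y hx hy => rw [map_add, add_add_add_comm]; exact add_mem hx hy
  | tmul c y =>
    have h1 : (c ⊗ₜ[ℝ] y : ℂ ⊗[ℝ] gR) + c ⊗ₜ[ℝ] θ y = c • (1 : ℂ) ⊗ₜ[ℝ] (y + θ y) := by
      rw [TensorProduct.smul_tmul', smul_eq_mul, mul_one, TensorProduct.tmul_add]
    rw [LinearMap.baseChange_tmul]
    refine (h1 ▸ Submodule.smul_mem _ c (hh _ ?_) : _ ∈ h)
    rw [map_add, hinv, add_comm]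

/-- A subalgebra containing the fixed points of an involution and an element of the `-1`-eigenspace
contains the eigenvectors of the latter for nonzero eigenvalues. -/
lemma mem_of_lie_eq_smul {h : LieSubalgebra ℂ (ℂ ⊗[ℝ] gR)} (hinv : ∀ x, θ (θ x) = x)
    (hh : ∀ y : gR, θ y = y → (1 : ℂ) ⊗ₜ[ℝ] y ∈ h) {x : ℂ ⊗[ℝ] gR} (hx : x ∈ h)
    (hxθ : (θ : gR →ₗ[ℝ] gR).baseChange ℂ x = -x) {c : ℂ} (hc : c ≠ 0) {z : ℂ ⊗[ℝ] gR}
    (hz : ⁅x, z⁆ = c • z) : z ∈ h := by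
  have h1 : z + (θ : gR →ₗ[ℝ] gR).baseChange ℂ z ∈ h :=
    add_baseChange_mem (h := h.toSubmodule) hinv hh z
  have h2 := h.lie_mem hx h1
  have h3 : ⁅x, (θ : gR →ₗ[ℝ] gR).baseChange ℂ z⁆ =
      -(c • (θ : gR →ₗ[ℝ] gR).baseChange ℂ z) := by
    rw [← map_smul, ← hz, baseChange_lie, hxθ, neg_lie, neg_neg]
  rw [lie_add, hz, h3] at h2
  have h4 := add_mem (h.smul_mem c h1) h2
  rw [smul_add, add_add_add_comm, add_neg_cancel, add_zero, ← two_smul ℂ (c • z), smul_smul] at h4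
  exact (h.toSubmodule.smul_mem_iff (mul_ne_zero two_ne_zero hc)).mp h4

variable [FiniteDimensional ℝ gR]

/-- The eigenvectors of a Cartan involution are `ad`-semisimple. -/
lemma isSemisimple_ad (hinv : ∀ x, θ (θ x) = x)
    (hneg : ∀ x : gR, x ≠ 0 → killingForm ℝ gR x (θ x) < 0) {y : gR} {ε : ℝ}
    (hy : θ y = ε • y) : (LieAlgebra.ad ℝ gR y).IsSemisimple := by
  let B : LinearMap.BilinForm ℝ gR := (killingForm ℝ gR).compl₂ (θ : gR →ₗ[ℝ] gR)
  have hB : ∀ x z, B x z = killingForm ℝ gR x (θ z) := fun _ _ => rfl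
  have hsymm : ∀ x z, B x z = B z x := by
    intro x z
    rw [hB, hB, ← killingForm_apply_involution hinv x, hinv]
    exact LieModule.traceForm_comm ℝ gR gR _ _
  have hskew : ∀ x z, B x ⁅y, z⁆ = -(ε * B ⁅y, x⁆ z) := by
    intro x z
    rw [hB, hB, LieHom.map_lie, hy, smul_lie, map_smul, smul_eq_mul, killingForm_lie_right,
      mul_neg]
  rw [Module.End.isSemisimple_iff]
  intro W hW
  refine ⟨LinearMap.BilinForm.orthogonal B W, ?_, ?_⟩
  · intro z hz
    rw [Submodule.mem_comap, LieAlgebra.ad_apply, LinearMap.BilinForm.mem_orthogonal_iff]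
    rw [LinearMap.BilinForm.mem_orthogonal_iff] at hz
    intro w hw
    have h1 : B ⁅y, w⁆ z = 0 := hz _ (hW hw)
    show B w ⁅y, z⁆ = 0
    rw [hskew, h1, mul_zero, neg_zero]
  · have hdef : ∀ w : gR, B w w = 0 → w = 0 := by
      intro w hw
      by_contra h
      exact (hneg w h).ne hw
    refine LinearMap.BilinForm.isCompl_orthogonal_of_restrict_nondegenerate
      (fun x z h => by rw [hsymm, h]) ⟨fun w hw => ?_, fun w hw => ?_⟩
    · exact Subtype.ext (hdef w (hw w))
    · exact Subtype.ext (hdef w (hw w))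

/-- Commuting eigenvectors of a Cartan involution are simultaneously diagonalizable in the
complexified adjoint representation. -/
lemma iSup_iInf_eigenspace_ad_eq_top (hinv : ∀ x, θ (θ x) = x)
    (hneg : ∀ x : gR, x ≠ 0 → killingForm ℝ gR x (θ x) < 0) {ι : Type*} {y : ι → gR} {ε : ℝ}
    (hy : ∀ i, θ (y i) = ε • y i) (hcomm : ∀ i j, ⁅y i, y j⁆ = 0) :
    ⨆ χ : ι → ℂ, ⨅ i, (LieAlgebra.ad ℂ (ℂ ⊗[ℝ] gR) (1 ⊗ₜ[ℝ] y i)).eigenspace (χ i) = ⊤ := by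
  have h := Module.End.iSup_iInf_maxGenEigenspace_eq_top_of_iSup_maxGenEigenspace_eq_top_of_commute
    (fun i => LieAlgebra.ad ℂ (ℂ ⊗[ℝ] gR) (1 ⊗ₜ[ℝ] y i)) (fun i j _ => ?_)
    fun i => Module.End.iSup_maxGenEigenspace_eq_top _
  · rw [← h]
    refine iSup_congr fun χ => iInf_congr fun i => ?_
    refine (Module.End.IsFinitelySemisimple.maxGenEigenspace_eq_eigenspace ?_ _).symm
    rw [ad_tmul]
    exact (isSemisimple_baseChange (isSemisimple_ad hinv hneg (hy i))).isFinitelySemisimple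
  · beta_reduce
    rw [commute_iff_lie_eq, ← LieHom.map_lie, LieAlgebra.ExtendScalars.bracket_tmul, hcomm,
      TensorProduct.tmul_zero, map_zero]

lemma isDiag_sum {g : Type*} [LieRing g] [LieAlgebra ℂ g] {ι : Type*} [Fintype ι] {b : ι → g}
    (hb : ⨆ χ : ι → ℂ, ⨅ i, (LieAlgebra.ad ℂ g (b i)).eigenspace (χ i) = ⊤) (a : ι → ℂ) :
    IsDiag (LieAlgebra.ad ℂ g (∑ i, a i • b i)) := by
  refine top_le_iff.mp (hb ▸ iSup_le fun χ z hz => mem_iSup_eigenspace (c := ∑ i, a i * χ i) ?_)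
  rw [map_sum, LinearMap.sum_apply, Finset.sum_smul]
  refine Finset.sum_congr rfl fun i _ => ?_
  rw [map_smul, LinearMap.smul_apply,
    Module.End.mem_eigenspace_iff.mp ((Submodule.mem_iInf _).mp hz i), smul_smul]

/-- Torsion-freeness in terms of a representation and a basis of the abelian subspace. -/
lemma apply_ne_zero {V : Type*} [AddCommGroup V] [Module ℂ V] [Nontrivial V]
    (hinv : ∀ x, θ (θ x) = x)
    (hneg : ∀ x : gR, x ≠ 0 → killingForm ℝ gR x (θ x) < 0)
    {π : ℂ ⊗[ℝ] gR →ₗ⁅ℂ⁆ Module.End ℂ V}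
    (hirr : ∀ N : Submodule ℂ V, (∀ x, ∀ v ∈ N, π x v ∈ N) → N = ⊥ ∨ N = ⊤)
    (hK : ∀ y : gR, θ y = y → LocFin (π (1 ⊗ₜ y)))
    (hfactor : ∀ I : LieIdeal ℂ (ℂ ⊗[ℝ] gR), IsAtom I → ¬ ∀ x ∈ I, LocFin (π x))
    {ι : Type*} [Fintype ι] {y : ι → gR} (hli : LinearIndependent ℝ y)
    (hyθ : ∀ i, θ (y i) = -y i) (hcomm : ∀ i j, ⁅y i, y j⁆ = 0)
    {φ : MvPolynomial ι ℂ →ₐ[ℂ] Module.End ℂ V} (hφ : ∀ i, φ (X i) = π (1 ⊗ₜ y i))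
    {f : MvPolynomial ι ℂ} (hf : f ≠ 0) {v : V} (hv : v ≠ 0) : φ f v ≠ 0 := by
  intro hfv
  have hb := iSup_iInf_eigenspace_ad_eq_top hinv hneg (y := y) (ε := -1)
    (fun i => by rw [hyθ, neg_one_smul]) hcomm
  obtain ⟨a, ha, w, hw, c, hc⟩ := exists_eigenvector_of_rep_torsion hirr hb hφ hf hv hfv
  set x := ∑ i, a i • (1 : ℂ) ⊗ₜ[ℝ] y i with hxdef
  have hx : IsDiag (LieAlgebra.ad ℂ (ℂ ⊗[ℝ] gR) x) := isDiag_sum hb a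
  have hxmem : x ∈ diagSubalgebra π :=
    Submodule.subset_span ⟨hx, isDiag_of_eigenvector hirr hx hw hc⟩
  have hfix : ∀ y : gR, θ y = y → (1 : ℂ) ⊗ₜ[ℝ] y ∈ diagSubalgebra π := by
    intro y hy
    have h1 := iSup_iInf_eigenspace_ad_eq_top hinv hneg (ι := Unit) (y := fun _ => y) (ε := 1)
      (fun _ => by rw [hy, one_smul]) fun _ _ => lie_self y
    have h2 := isDiag_sum h1 1
    rw [Fintype.sum_unique, Pi.one_apply, one_smul] at h2
    obtain ⟨w, hw, c, hc⟩ := (hK y hy).exists_eigenvector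
    exact Submodule.subset_span ⟨h2, isDiag_of_eigenvector hirr h2 hw hc⟩
  have hxθ : (θ : gR →ₗ[ℝ] gR).baseChange ℂ x = -x := by
    rw [hxdef, map_sum, ← Finset.sum_neg_distrib]
    refine Finset.sum_congr rfl fun i _ => ?_
    rw [map_smul, LinearMap.baseChange_tmul, LieHom.coe_toLinearMap, hyθ, TensorProduct.tmul_neg,
      smul_neg]
  obtain ⟨I, hI, hIh⟩ := exists_ideal_le hx
    (fun c z hc hz => mem_of_lie_eq_smul hinv hfix hxmem hxθ hc hz)
    (exists_lie_ne_zero hneg hli ha)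
  obtain ⟨J, hJ, hJI⟩ := (eq_bot_or_exists_atom_le I).resolve_left hI
  exact hfactor J hJ fun z hz => locFin_of_mem_diagSubalgebra (hIh z (hJI hz))

end Cartan

section Enveloping

attribute [local instance] LieRing.ofAssociativeRing

lemma exists_algHom_of_commute {A ι : Type*} [Ring A] [Algebra ℂ A] {x : ι → A}
    (h : ∀ i j, x i * x j = x j * x i) :
    ∃ φ : MvPolynomial ι ℂ →ₐ[ℂ] A, ∀ i, φ (X i) = x i := by
  have hc : IsMulCommutative (Algebra.adjoin ℂ (Set.range x)) :=
    Algebra.isMulCommutative_adjoin ℂ (by rintro _ ⟨i, rfl⟩ _ ⟨j, rfl⟩; exact h i j)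
  let _ : CommRing (Algebra.adjoin ℂ (Set.range x)) := { mul_comm := hc.1.1 }
  refine ⟨(Algebra.adjoin ℂ (Set.range x)).val.comp
    (aeval fun i => ⟨x i, Algebra.subset_adjoin ⟨i, rfl⟩⟩), fun i => ?_⟩
  rw [AlgHom.comp_apply, aeval_X]
  rfl

variable {g : Type*} [LieRing g] [LieAlgebra ℂ g] {V : Type*} [AddCommGroup V] [Module ℂ V]
  [Module (UniversalEnvelopingAlgebra ℂ g) V] [IsScalarTower ℂ (UniversalEnvelopingAlgebra ℂ g) V]

variable (g V) in
/-- The representation on a module over the enveloping algebra. -/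
noncomputable def rep : g →ₗ⁅ℂ⁆ Module.End ℂ V :=
  ((Algebra.lsmul ℂ ℂ V : UniversalEnvelopingAlgebra ℂ g →ₐ[ℂ] Module.End ℂ V) :
    UniversalEnvelopingAlgebra ℂ g →ₗ⁅ℂ⁆ Module.End ℂ V).comp (UniversalEnvelopingAlgebra.ι ℂ)

lemma smul_mem_of_rep_mem {N : Submodule ℂ V} (hN : ∀ x, ∀ v ∈ N, rep g V x v ∈ N)
    (u : UniversalEnvelopingAlgebra ℂ g) {v : V} (hv : v ∈ N) : u • v ∈ N := by
  let S : Subalgebra ℂ (UniversalEnvelopingAlgebra ℂ g) :=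
    { carrier := {u | ∀ v ∈ N, u • v ∈ N}
      mul_mem' := fun {a b} ha hb v hv => by rw [mul_smul]; exact ha _ (hb _ hv)
      add_mem' := fun {a b} ha hb v hv => by rw [add_smul]; exact add_mem (ha _ hv) (hb _ hv)
      algebraMap_mem' := fun c v hv => by
        rw [algebraMap_smul]; exact Submodule.smul_mem _ _ hv }
  let j : g →ₗ⁅ℂ⁆ S :=
    { toFun := fun x => ⟨UniversalEnvelopingAlgebra.ι ℂ x, hN x⟩
      map_add' := fun x y => Subtype.ext (map_add _ x y)
      map_smul' := fun c x => Subtype.ext (map_smul _ c x)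
      map_lie' := fun {x y} => Subtype.ext (LieHom.map_lie _ x y) }
  have h : S.val.comp (UniversalEnvelopingAlgebra.lift ℂ j) = AlgHom.id ℂ _ := by
    ext x
    simp [j]
  have := DFunLike.congr_fun h u
  rw [AlgHom.comp_apply, AlgHom.id_apply] at this
  rw [← this]
  exact (UniversalEnvelopingAlgebra.lift ℂ j u).2 v hv

lemma rep_irreducible
    (hirr : ∀ N : Submodule (UniversalEnvelopingAlgebra ℂ g) V, N = ⊥ ∨ N = ⊤)
    (N : Submodule ℂ V) (hN : ∀ x, ∀ v ∈ N, rep g V x v ∈ N) : N = ⊥ ∨ N = ⊤ := by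
  let N' : Submodule (UniversalEnvelopingAlgebra ℂ g) V :=
    { N with smul_mem' := fun u _ hv => smul_mem_of_rep_mem hN u hv }
  have hmem : ∀ v, v ∈ N' ↔ v ∈ N := fun _ => Iff.rfl
  refine (hirr N').imp (fun h => ?_) fun h => ?_
  · ext v
    rw [← hmem, h, Submodule.mem_bot, Submodule.mem_bot]
  · ext v
    rw [← hmem, h]
    simp only [Submodule.mem_top]

/-- The subalgebra generated by an abelian real subspace is a quotient of a polynomial ring. -/
lemma exists_polynomial {gR : Type*} [LieRing gR] [LieAlgebra ℝ gR] {aR : Submodule ℝ gR}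
    (hab : ∀ x ∈ aR, ∀ y ∈ aR, ⁅x, y⁆ = (0 : gR)) {ι : Type*} (b : Module.Basis ι ℝ aR) :
    ∃ ψ : MvPolynomial ι ℂ →ₐ[ℂ] UniversalEnvelopingAlgebra ℂ (ℂ ⊗[ℝ] gR),
      (∀ i, ψ (X i) = UniversalEnvelopingAlgebra.ι ℂ ((1 : ℂ) ⊗ₜ[ℝ] (b i : gR))) ∧
      Algebra.adjoin ℂ {w | ∃ y ∈ aR, w = UniversalEnvelopingAlgebra.ι ℂ ((1 : ℂ) ⊗ₜ[ℝ] y)} ≤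
        ψ.range := by
  obtain ⟨ψ, hψ⟩ := exists_algHom_of_commute
    (x := fun i => UniversalEnvelopingAlgebra.ι ℂ ((1 : ℂ) ⊗ₜ[ℝ] (b i : gR))) fun i j => by
      rw [← sub_eq_zero, ← Ring.lie_def, ← LieHom.map_lie, LieAlgebra.ExtendScalars.bracket_tmul,
        hab _ (b i).2 _ (b j).2, TensorProduct.tmul_zero, map_zero]
  refine ⟨ψ, hψ, Algebra.adjoin_le ?_⟩
  rintro _ ⟨y, hy, rfl⟩
  rw [show y = ((⟨y, hy⟩ : aR) : gR) from rfl]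
  generalize (⟨y, hy⟩ : aR) = z
  induction b.mem_span z using Submodule.span_induction with
  | zero => rw [Submodule.coe_zero, TensorProduct.tmul_zero, map_zero]; exact zero_mem _
  | add x y _ _ hx hy =>
    rw [Submodule.coe_add, TensorProduct.tmul_add, map_add]; exact add_mem hx hy
  | smul c x _ hx =>
    rw [Submodule.coe_smul, ← TensorProduct.smul_tmul, ← mul_one (c • (1 : ℂ)), ← smul_eq_mul,
      ← TensorProduct.smul_tmul', map_smul]
    exact Subalgebra.smul_mem _ hx _
  | mem x hx => obtain ⟨i, rfl⟩ := hx; exact ⟨X i, hψ i⟩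

end Enveloping

end SplitAbelian

/-- Theorem `AbelianGK`.
Let `g_ℝ` be a real semisimple Lie algebra with Cartan involution `θ`, `g = ℂ ⊗ g_ℝ` its
complexification, and `a_ℝ ⊆ g_ℝ^{-θ}` a maximal abelian subspace.  Let `V` be an
irreducible `(g, K)`-module (`k = g^θ` acts locally finitely) such that no simple factor
of `g` acts locally finitely on `V`.  Then `V` is torsion-free over `U(a) = S(a)`: every
nonzero element of the subalgebra of `U(g)` generated by `a` acts injectively on `V`.
Equivalently `Ass_{S(a)}(V) = {(0)}`. -/
theorem torsionFree_over_split_abelian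
    (gR : Type*) [LieRing gR] [LieAlgebra ℝ gR] [FiniteDimensional ℝ gR]
    [LieAlgebra.IsSemisimple ℝ gR]
    (θ : gR →ₗ⁅ℝ⁆ gR) (hθ_invol : ∀ x, θ (θ x) = x)
    (hθ_cartan : ∀ x : gR, x ≠ 0 → killingForm ℝ gR x (θ x) < 0)
    (aR : Submodule ℝ gR)
    (haθ : ∀ x ∈ aR, θ x = -x)
    (hab : ∀ x ∈ aR, ∀ y ∈ aR, ⁅x, y⁆ = (0 : gR))
    (hmax : ∀ x : gR, θ x = -x → (∀ y ∈ aR, ⁅x, y⁆ = (0 : gR)) → x ∈ aR)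
    (V : Type*) [AddCommGroup V] [Module ℂ V]
    [Module (UniversalEnvelopingAlgebra ℂ (ℂ ⊗[ℝ] gR)) V]
    [IsScalarTower ℂ (UniversalEnvelopingAlgebra ℂ (ℂ ⊗[ℝ] gR)) V]
    [Nontrivial V]
    (hirr : ∀ N : Submodule (UniversalEnvelopingAlgebra ℂ (ℂ ⊗[ℝ] gR)) V,
      N = ⊥ ∨ N = ⊤)
    (hK : ∀ y : gR, θ y = y → ∀ v : V, ∃ S : Submodule ℂ V,
      FiniteDimensional ℂ S ∧ v ∈ S ∧ ∀ w ∈ S,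
        (UniversalEnvelopingAlgebra.ι ℂ ((1 : ℂ) ⊗ₜ[ℝ] y) :
          UniversalEnvelopingAlgebra ℂ (ℂ ⊗[ℝ] gR)) • w ∈ S)
    (hnofactor : ∀ I : LieIdeal ℂ (ℂ ⊗[ℝ] gR), IsAtom I →
      ¬ (∀ x : ℂ ⊗[ℝ] gR, x ∈ I → ∀ v : V, ∃ S : Submodule ℂ V,
        FiniteDimensional ℂ S ∧ v ∈ S ∧ ∀ w ∈ S,
          (UniversalEnvelopingAlgebra.ι ℂ x :
            UniversalEnvelopingAlgebra ℂ (ℂ ⊗[ℝ] gR)) • w ∈ S)) :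
    ∀ u : UniversalEnvelopingAlgebra ℂ (ℂ ⊗[ℝ] gR),
      u ∈ Algebra.adjoin ℂ
        {w : UniversalEnvelopingAlgebra ℂ (ℂ ⊗[ℝ] gR) |
          ∃ y ∈ aR, w = UniversalEnvelopingAlgebra.ι ℂ ((1 : ℂ) ⊗ₜ[ℝ] y)} →
      u ≠ 0 → ∀ v : V, v ≠ 0 → u • v ≠ 0 := by
  intro u hu hu0 v hv
  have hcomm : ∀ i j, ⁅(Module.finBasis ℝ aR i : gR), (Module.finBasis ℝ aR j : gR)⁆ = 0 :=
    fun i j => hab _ (Module.finBasis ℝ aR i).2 _ (Module.finBasis ℝ aR j).2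
  obtain ⟨ψ, hψ, hle⟩ := SplitAbelian.exists_polynomial hab (Module.finBasis ℝ aR)
  obtain ⟨f, rfl⟩ := hle hu
  have hf : f ≠ 0 := by
    rintro rfl
    exact hu0 (map_zero ψ)
  have hli : LinearIndependent ℝ fun i => (Module.finBasis ℝ aR i : gR) :=
    (Module.finBasis ℝ aR).linearIndependent.map' aR.subtype aR.ker_subtype
  exact SplitAbelian.apply_ne_zero hθ_invol hθ_cartan
    (π := SplitAbelian.rep (ℂ ⊗[ℝ] gR) V) (SplitAbelian.rep_irreducible hirr) hK hnofactor hli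
    (fun i => haθ _ (Module.finBasis ℝ aR i).2) hcomm (φ := (Algebra.lsmul ℂ ℂ V).comp ψ)
    (fun i => congrArg (Algebra.lsmul ℂ ℂ V) (hψ i)) hf hv
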